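/- Let σx = [[0,1],[1,0]] and σy = [[0,−i],[i,0]] be Pauli matrices over ℂ, let G be the 8×8 projector onto (|000⟩+|111⟩)/√2 and ρ₁(v₁) = v₁·G + (1−v₁)·I₈/8, and let W(v₂) = v₂·Φ + (1−v₂)·I₄/4 where Φ is the projector onto (|00⟩+|11⟩)/√2. Define D_x = (σx + (−1)^x σy)/√2 for x ∈ {0,1}, E₀ = σx ⊗ σx and E₁ = σy ⊗ σy. Writing T(x¹,x²,x³,x⁴) for the trace of the 32×32 matrix (ρ₁(v₁) ⊗ W(v₂)) · (D_{x¹} ⊗ D_{x²} ⊗ E_{x³} ⊗ D_{x⁴}), one has, for all v₁, v₂ ∈ ℝ: (1/4)[T(0,1,0,0) + T(1,0,0,0) + T(0,1,0,1) + T(1,0,0,1)] = v₁v₂/√2 and (1/4)[T(0,0,1,0) − T(1,1,1,0) − T(0,0,1,1) + T(1,1,1,1)] = v₁v₂/√2. -/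

import Mathlib

open Matrix Kronecker

namespace Stmt15

noncomputable section

/-- The Pauli matrix `σx`. -/
def σx : Matrix (Fin 2) (Fin 2) ℂ := !![0, 1; 1, 0]

/-- The Pauli matrix `σy`. -/
def σy : Matrix (Fin 2) (Fin 2) ℂ := !![0, -Complex.I; Complex.I, 0]

/-- The 8×8 projector `G` onto `(|000⟩+|111⟩)/√2`, the eight basis states being indexed by
`Fin 2 × Fin 2 × Fin 2`: entries are `1/2` exactly on rows/columns `000` and `111`. -/
def G : Matrix (Fin 2 × Fin 2 × Fin 2) (Fin 2 × Fin 2 × Fin 2) ℂ :=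
  Matrix.of fun p q =>
    if (p.1 = p.2.1 ∧ p.2.1 = p.2.2) ∧ (q.1 = q.2.1 ∧ q.2.1 = q.2.2) then (1/2 : ℂ) else 0

/-- The noisy GHZ state `ρ₁(v₁) = v₁·G + (1−v₁)·I₈/8`. -/
def ρGHZ (v : ℝ) : Matrix (Fin 2 × Fin 2 × Fin 2) (Fin 2 × Fin 2 × Fin 2) ℂ :=
  (v : ℂ) • G + ((1 - v : ℝ) : ℂ) •
    ((8 : ℂ)⁻¹ • (1 : Matrix (Fin 2 × Fin 2 × Fin 2) (Fin 2 × Fin 2 × Fin 2) ℂ))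

/-- The projector `Φ` onto `(|00⟩+|11⟩)/√2`. -/
def Φ : Matrix (Fin 2 × Fin 2) (Fin 2 × Fin 2) ℂ :=
  Matrix.of fun p q => if p.1 = p.2 ∧ q.1 = q.2 then (1/2 : ℂ) else 0

/-- The two-qubit Werner state `W(v) = v·Φ + (1−v)·I₄/4`. -/
def W (v : ℝ) : Matrix (Fin 2 × Fin 2) (Fin 2 × Fin 2) ℂ :=
  (v : ℂ) • Φ + ((1 - v : ℝ) : ℂ) • ((4 : ℂ)⁻¹ • (1 : Matrix (Fin 2 × Fin 2) (Fin 2 × Fin 2) ℂ))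

/-- The measurement `D_x = (σx + (−1)^x σy)/√2` for `x ∈ {0,1}`. -/
def D (x : Fin 2) : Matrix (Fin 2) (Fin 2) ℂ :=
  ((Real.sqrt 2 : ℂ))⁻¹ • (σx + ((-1 : ℂ) ^ (x : ℕ)) • σy)

/-- The measurement `E₀ = σx ⊗ σx`, `E₁ = σy ⊗ σy` (Kronecker products). -/
def E (x : Fin 2) : Matrix (Fin 2 × Fin 2) (Fin 2 × Fin 2) ℂ :=
  if x = 0 then σx ⊗ₖ σx else σy ⊗ₖ σy

/-- Canonical identification `((q1,(q2,q3)),(q4,q5)) ≃ (q1,(q2,(q3,(q4,q5))))` of the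
32-dimensional index sets (associativity of the Kronecker product), state side. -/
def eL : (Fin 2 × Fin 2 × Fin 2) × (Fin 2 × Fin 2) ≃ Fin 2 × Fin 2 × Fin 2 × Fin 2 × Fin 2 :=
  (Equiv.prodAssoc (Fin 2) (Fin 2 × Fin 2) (Fin 2 × Fin 2)).trans
    ((Equiv.refl (Fin 2)).prodCongr (Equiv.prodAssoc (Fin 2) (Fin 2) (Fin 2 × Fin 2)))

/-- Canonical identification `(q1,(q2,((q3,q4),q5))) ≃ (q1,(q2,(q3,(q4,q5))))`,
measurement side. -/
def eR : Fin 2 × Fin 2 × (Fin 2 × Fin 2) × Fin 2 ≃ Fin 2 × Fin 2 × Fin 2 × Fin 2 × Fin 2 :=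
  (Equiv.refl (Fin 2)).prodCongr
    ((Equiv.refl (Fin 2)).prodCongr (Equiv.prodAssoc (Fin 2) (Fin 2) (Fin 2)))

/-- The correlator `T(x¹,x²,x³,x⁴)`: the trace of the 32×32 matrix
`(ρ₁(v₁) ⊗ W(v₂)) · (D_{x¹} ⊗ D_{x²} ⊗ E_{x³} ⊗ D_{x⁴})`. -/
def T (v₁ v₂ : ℝ) (x1 x2 x3 x4 : Fin 2) : ℂ :=
  Matrix.trace
    ((Matrix.reindex eL eL (ρGHZ v₁ ⊗ₖ W v₂))
      * (Matrix.reindex eR eR (D x1 ⊗ₖ (D x2 ⊗ₖ (E x3 ⊗ₖ D x4)))))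

/-- Reassociating a five-fold Kronecker product of local observables: the measurement-side
grouping agrees with the state-side grouping. -/
lemma reindex_eR_kronecker (A B C C' F : Matrix (Fin 2) (Fin 2) ℂ) :
    Matrix.reindex eR eR (A ⊗ₖ (B ⊗ₖ ((C ⊗ₖ C') ⊗ₖ F)))
      = Matrix.reindex eL eL ((A ⊗ₖ (B ⊗ₖ C)) ⊗ₖ (C' ⊗ₖ F)) := by
  ext ⟨a, b, c, d, e⟩ ⟨a', b', c', d', e'⟩
  simp [eR, eL, Matrix.kroneckerMap_apply, mul_assoc]

lemma trace_reindex_mul_kronecker (R : Matrix (Fin 2 × Fin 2 × Fin 2) (Fin 2 × Fin 2 × Fin 2) ℂ)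
    (S : Matrix (Fin 2 × Fin 2) (Fin 2 × Fin 2) ℂ) (A B C C' F : Matrix (Fin 2) (Fin 2) ℂ) :
    Matrix.trace (Matrix.reindex eL eL (R ⊗ₖ S)
        * Matrix.reindex eR eR (A ⊗ₖ (B ⊗ₖ ((C ⊗ₖ C') ⊗ₖ F))))
      = Matrix.trace (R * (A ⊗ₖ (B ⊗ₖ C))) * Matrix.trace (S * (C' ⊗ₖ F)) := by
  rw [reindex_eR_kronecker, Matrix.reindex_apply, Matrix.reindex_apply,
    Matrix.submatrix_mul_equiv, ← Matrix.mul_kronecker_mul, ← Matrix.trace_kronecker]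
  exact Equiv.sum_comp eL.symm fun i => ((R * (A ⊗ₖ (B ⊗ₖ C))) ⊗ₖ (S * (C' ⊗ₖ F))) i i

lemma trace_ρGHZ_mul_kronecker (v : ℝ) (A B C : Matrix (Fin 2) (Fin 2) ℂ) :
    Matrix.trace (ρGHZ v * (A ⊗ₖ (B ⊗ₖ C)))
      = v / 2 * (A 0 0 * B 0 0 * C 0 0 + A 0 1 * B 0 1 * C 0 1
          + A 1 0 * B 1 0 * C 1 0 + A 1 1 * B 1 1 * C 1 1)
        + (1 - v) / 8 * (A.trace * (B.trace * C.trace)) := by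
  have hG : Matrix.trace (G * (A ⊗ₖ (B ⊗ₖ C)))
      = 1 / 2 * (A 0 0 * B 0 0 * C 0 0 + A 0 1 * B 0 1 * C 0 1
          + A 1 0 * B 1 0 * C 1 0 + A 1 1 * B 1 1 * C 1 1) := by
    simp [G, Matrix.trace, Matrix.mul_apply, Fintype.sum_prod_type]
    ring
  simp only [ρGHZ, add_mul, Matrix.smul_mul, one_mul, Matrix.trace_add, Matrix.trace_smul,
    Matrix.trace_kronecker, hG, smul_eq_mul]
  push_cast
  ring

lemma trace_W_mul_kronecker (v : ℝ) (A B : Matrix (Fin 2) (Fin 2) ℂ) :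
    Matrix.trace (W v * (A ⊗ₖ B))
      = v / 2 * (A 0 0 * B 0 0 + A 0 1 * B 0 1 + A 1 0 * B 1 0 + A 1 1 * B 1 1)
        + (1 - v) / 4 * (A.trace * B.trace) := by
  have hΦ : Matrix.trace (Φ * (A ⊗ₖ B))
      = 1 / 2 * (A 0 0 * B 0 0 + A 0 1 * B 0 1 + A 1 0 * B 1 0 + A 1 1 * B 1 1) := by
    simp [Φ, Matrix.trace, Matrix.mul_apply, Fintype.sum_prod_type]
    ring
  simp only [W, add_mul, Matrix.smul_mul, one_mul, Matrix.trace_add, Matrix.trace_smul,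
    Matrix.trace_kronecker, hΦ, smul_eq_mul]
  push_cast
  ring

lemma T_σx (v₁ v₂ : ℝ) (x1 x2 x4 : Fin 2) :
    T v₁ v₂ x1 x2 0 x4 = v₁ * v₂ * ((Real.sqrt 2 : ℂ))⁻¹ ^ 3
      * (1 - (-1) ^ (x1 : ℕ) * (-1) ^ (x2 : ℕ)) := by
  rw [T, E, if_pos rfl, trace_reindex_mul_kronecker, trace_ρGHZ_mul_kronecker,
    trace_W_mul_kronecker]
  simp [D, σx, σy, Matrix.trace_fin_two]
  ring_nf
  simp only [Complex.I_sq]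
  ring

lemma T_σy (v₁ v₂ : ℝ) (x1 x2 x4 : Fin 2) :
    T v₁ v₂ x1 x2 1 x4 = v₁ * v₂ * ((Real.sqrt 2 : ℂ))⁻¹ ^ 3
      * ((-1) ^ (x1 : ℕ) + (-1) ^ (x2 : ℕ)) * (-1) ^ (x4 : ℕ) := by
  rw [T, E, if_neg one_ne_zero, trace_reindex_mul_kronecker, trace_ρGHZ_mul_kronecker,
    trace_W_mul_kronecker]
  simp [D, σx, σy, Matrix.trace_fin_two]
  ring_nf
  simp only [Complex.I_pow_four]
  ring

lemma inv_sqrt_two_pow_three : ((Real.sqrt 2 : ℂ))⁻¹ ^ 3 = 1 / 2 * ((Real.sqrt 2 : ℂ))⁻¹ := by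
  have h : ((Real.sqrt 2 : ℂ)) ^ 2 = 2 := by
    exact_mod_cast Real.sq_sqrt (zero_le_two (α := ℝ))
  rw [pow_succ, inv_pow, h, one_div]

/-- For all `v₁, v₂ ∈ ℝ`:
`(1/4)[T(0,1,0,0) + T(1,0,0,0) + T(0,1,0,1) + T(1,0,0,1)] = v₁v₂/√2` and
`(1/4)[T(0,0,1,0) − T(1,1,1,0) − T(0,0,1,1) + T(1,1,1,1)] = v₁v₂/√2`. -/
theorem trace_ghz_werner (v₁ v₂ : ℝ) :
    (1/4 : ℂ) * (T v₁ v₂ 0 1 0 0 + T v₁ v₂ 1 0 0 0 + T v₁ v₂ 0 1 0 1 + T v₁ v₂ 1 0 0 1)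
        = ((v₁ * v₂ / Real.sqrt 2 : ℝ) : ℂ)
    ∧ (1/4 : ℂ) * (T v₁ v₂ 0 0 1 0 - T v₁ v₂ 1 1 1 0 - T v₁ v₂ 0 0 1 1 + T v₁ v₂ 1 1 1 1)
        = ((v₁ * v₂ / Real.sqrt 2 : ℝ) : ℂ) := by
  simp only [T_σx, T_σy, inv_sqrt_two_pow_three]
  push_cast
  constructor <;> norm_num <;> ring

end

end Stmt15
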